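/- Let n ≥ 1 be an integer and δ ∈ (0, n]. There exists a constant c > 0, depending only on n and δ, such that for every f ∈ BLO(ℝⁿ, ℋ^δ_∞) with ‖f‖_{BLO(ℝⁿ,ℋ^δ_∞)} ≠ 0, the function x ↦ exp(c f(x)/‖f‖_{BLO(ℝⁿ,ℋ^δ_∞)}) belongs to A_{1,δ}. -/

import Mathlib

open scoped ENNReal
open Set MeasureTheory

noncomputable section

/-- An axis-parallel cube in `ℝⁿ`, described by its lower corner and positive side length. -/
structure Cube (n : ℕ) where
  corner : Fin n → ℝ
  side : ℝ
  side_pos : 0 < side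

namespace Cube

/-- The half-open cube `∏ᵢ [cornerᵢ, cornerᵢ + side)` as a set of points. -/
def toSet {n : ℕ} (Q : Cube n) : Set (Fin n → ℝ) :=
  {x | ∀ i, Q.corner i ≤ x i ∧ x i < Q.corner i + Q.side}

/-- A cube is dyadic if it has the form `2^k·(z + [0,1)ⁿ)` with `k ∈ ℤ`, `z ∈ ℤⁿ`. -/
def IsDyadic {n : ℕ} (Q : Cube n) : Prop :=
  ∃ (k : ℤ) (z : Fin n → ℤ), Q.side = (2:ℝ) ^ k ∧ ∀ i, Q.corner i = (z i : ℝ) * (2:ℝ) ^ k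

/-- `Q'` is a dyadic subcube of `Q`, i.e. obtained from `Q` by repeated bisection. -/
def IsDyadicSubcube {n : ℕ} (Q' Q : Cube n) : Prop :=
  ∃ (k : ℕ) (z : Fin n → ℕ), (∀ i, z i < 2 ^ k) ∧
    Q'.side = Q.side / 2 ^ k ∧ ∀ i, Q'.corner i = Q.corner i + (z i : ℝ) * (Q.side / 2 ^ k)

/-- The concentric dilate `t·Q` of a cube. -/
def dilate {n : ℕ} (Q : Cube n) (t : ℝ) (ht : 0 < t) : Cube n :=
  ⟨fun i => Q.corner i + Q.side / 2 - t * Q.side / 2, t * Q.side, mul_pos ht Q.side_pos⟩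

end Cube

/-- The Hausdorff content `ℋ^δ_∞`. -/
def hContent (n : ℕ) (δ : ℝ) (E : Set (Fin n → ℝ)) : ℝ≥0∞ :=
  ⨅ (Qs : ℕ → Cube n) (_ : E ⊆ ⋃ i, (Qs i).toSet), ∑' i, ENNReal.ofReal ((Qs i).side ^ δ)

/-- The dyadic Hausdorff content `~ℋ^δ_∞`. -/
def dContent (n : ℕ) (δ : ℝ) (E : Set (Fin n → ℝ)) : ℝ≥0∞ :=
  ⨅ (Qs : ℕ → Cube n) (_ : (∀ i, (Qs i).IsDyadic) ∧ E ⊆ ⋃ i, (Qs i).toSet),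
    ∑' i, ENNReal.ofReal ((Qs i).side ^ δ)

/-- The Choquet integral `∫_E f dℋ^δ_∞`. -/
def integH (n : ℕ) (δ : ℝ) (f : (Fin n → ℝ) → ℝ) (E : Set (Fin n → ℝ)) : ℝ≥0∞ :=
  ∫⁻ t in Ioi (0:ℝ), hContent n δ {x | x ∈ E ∧ t < f x}

/-- The Choquet integral `∫_E f d~ℋ^δ_∞` w.r.t. the dyadic Hausdorff content. -/
def integD (n : ℕ) (δ : ℝ) (f : (Fin n → ℝ) → ℝ) (E : Set (Fin n → ℝ)) : ℝ≥0∞ :=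
  ∫⁻ t in Ioi (0:ℝ), dContent n δ {x | x ∈ E ∧ t < f x}

/-- A property holds `ℋ^δ_∞`-a.e. -/
def AEContent (n : ℕ) (δ : ℝ) (P : (Fin n → ℝ) → Prop) : Prop :=
  hContent n δ {x | ¬ P x} = 0

/-- `ℋ^δ_∞`-quasicontinuity. -/
def QuasiCont (n : ℕ) (δ : ℝ) (f : (Fin n → ℝ) → ℝ) : Prop :=
  ∀ ε : ℝ, 0 < ε → ∃ O : Set (Fin n → ℝ),
    IsOpen O ∧ hContent n δ O < ENNReal.ofReal ε ∧ ContinuousOn f Oᶜ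

/-- `L¹_loc(ℝⁿ, ℋ^δ_∞)`. -/
def MemL1loc (n : ℕ) (δ : ℝ) (f : (Fin n → ℝ) → ℝ) : Prop :=
  QuasiCont n δ f ∧ ∀ K : Set (Fin n → ℝ), IsCompact K → integH n δ (fun x => |f x|) K < ⊤

/-- `L^∞(ℝⁿ, ℋ^δ_∞)`. -/
def MemLinf (n : ℕ) (δ : ℝ) (f : (Fin n → ℝ) → ℝ) : Prop :=
  QuasiCont n δ f ∧ ∃ M : ℝ, AEContent n δ (fun x => |f x| ≤ M)

/-- The `BMO(ℝⁿ, ℋ^δ_∞)` seminorm. -/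
def bmoNorm (n : ℕ) (δ : ℝ) (f : (Fin n → ℝ) → ℝ) : ℝ≥0∞ :=
  ⨆ Q : Cube n, ⨅ c : ℝ,
    integH n δ (fun x => |f x - c|) Q.toSet / hContent n δ Q.toSet

/-- Membership in `BMO(ℝⁿ, ℋ^δ_∞)`. -/
def MemBMO (n : ℕ) (δ : ℝ) (f : (Fin n → ℝ) → ℝ) : Prop :=
  MemL1loc n δ f ∧ bmoNorm n δ f < ⊤

/-- `essinf_{x ∈ Q} f := inf {t ∈ (0,∞) : ℋ^δ_∞({x ∈ Q : f x < t}) > 0}`. -/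
def essInfQ (n : ℕ) (δ : ℝ) (f : (Fin n → ℝ) → ℝ) (Q : Cube n) : ℝ :=
  sInf {t : ℝ | 0 < t ∧ 0 < hContent n δ {x | x ∈ Q.toSet ∧ f x < t}}

/-- The `BLO(ℝⁿ, ℋ^δ_∞)` seminorm. -/
def bloNorm (n : ℕ) (δ : ℝ) (f : (Fin n → ℝ) → ℝ) : ℝ≥0∞ :=
  ⨆ Q : Cube n,
    integH n δ (fun x => |f x - essInfQ n δ f Q|) Q.toSet / hContent n δ Q.toSet

/-- Membership in `BLO(ℝⁿ, ℋ^δ_∞)`. -/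
def MemBLO (n : ℕ) (δ : ℝ) (f : (Fin n → ℝ) → ℝ) : Prop :=
  MemL1loc n δ f ∧ bloNorm n δ f < ⊤

/-- A weight: locally Choquet-integrable, quasicontinuous, positive `ℋ^δ_∞`-a.e. -/
def IsWeight (n : ℕ) (δ : ℝ) (w : (Fin n → ℝ) → ℝ) : Prop :=
  MemL1loc n δ w ∧ AEContent n δ (fun x => 0 < w x)

/-- The capacitary Muckenhoupt `A_{p,δ}` constant, for `p > 1`. -/
def apConst (n : ℕ) (δ p : ℝ) (w : (Fin n → ℝ) → ℝ) : ℝ≥0∞ :=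
  ⨆ Q : Cube n,
    (integH n δ w Q.toSet / hContent n δ Q.toSet) *
      (integH n δ (fun x => w x ^ (-(1 / (p - 1)))) Q.toSet / hContent n δ Q.toSet) ^ (p - 1)

/-- Membership in `A_{p,δ}`, `p > 1`. -/
def MemAp (n : ℕ) (δ p : ℝ) (w : (Fin n → ℝ) → ℝ) : Prop :=
  IsWeight n δ w ∧ apConst n δ p w < ⊤

/-- The Hardy–Littlewood maximal operator w.r.t. `ℋ^δ_∞`. -/
def maxOp (n : ℕ) (δ : ℝ) (g : (Fin n → ℝ) → ℝ) (x : Fin n → ℝ) : ℝ≥0∞ :=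
  ⨆ (Q : Cube n) (_ : x ∈ Q.toSet),
    integH n δ (fun y => |g y|) Q.toSet / hContent n δ Q.toSet

/-- The capacitary `A_{1,δ}` constant. -/
def a1Const (n : ℕ) (δ : ℝ) (w : (Fin n → ℝ) → ℝ) : ℝ≥0∞ :=
  sInf {c : ℝ≥0∞ | 0 < c ∧
    AEContent n δ (fun x => maxOp n δ w x ≤ c * ENNReal.ofReal (w x))}

/-- Membership in `A_{1,δ}`. -/
def MemA1 (n : ℕ) (δ : ℝ) (w : (Fin n → ℝ) → ℝ) : Prop :=
  IsWeight n δ w ∧ a1Const n δ w < ⊤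

/-- The `A_{p,δ}` constant for `p ∈ [1,∞)` (it is the `A_{1,δ}` constant when `p = 1`). -/
def apConstGen (n : ℕ) (δ p : ℝ) (w : (Fin n → ℝ) → ℝ) : ℝ≥0∞ :=
  if p = 1 then a1Const n δ w else apConst n δ p w

/-- Membership in `A_{p,δ}` for `p ∈ [1,∞)` (meaning `A_{1,δ}` when `p = 1`). -/
def MemApGen (n : ℕ) (δ p : ℝ) (w : (Fin n → ℝ) → ℝ) : Prop :=
  IsWeight n δ w ∧ apConstGen n δ p w < ⊤

/-- The weighted `BMO^q_w(ℝⁿ, ℋ^δ_∞)` seminorm. -/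
def bmoWNorm (n : ℕ) (δ q : ℝ) (w f : (Fin n → ℝ) → ℝ) : ℝ≥0∞ :=
  ⨆ Q : Cube n, ⨅ c : ℝ,
    (integH n δ (fun x => |f x - c| ^ q * w x) Q.toSet / integH n δ w Q.toSet) ^ (1 / q)

/-- Membership in `BMO^q_w(ℝⁿ, ℋ^δ_∞)`. -/
def MemBMOw (n : ℕ) (δ q : ℝ) (w f : (Fin n → ℝ) → ℝ) : Prop :=
  QuasiCont n δ f ∧
    (∀ K : Set (Fin n → ℝ), IsCompact K → integH n δ (fun x => |f x| ^ q * w x) K < ⊤) ∧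
    bmoWNorm n δ q w f < ⊤

/-- The integral average `f_{Q,δ}` with respect to the dyadic Hausdorff content. -/
def avgQ (n : ℕ) (δ : ℝ) (f : (Fin n → ℝ) → ℝ) (Q : Cube n) : ℝ :=
  ((integD n δ f (Q.toSet ∩ {x | 0 ≤ f x})).toReal -
      (integD n δ (fun x => -f x) (Q.toSet ∩ {x | f x < 0})).toReal) /
    ((dContent n δ (Q.toSet ∩ {x | 0 ≤ f x})).toReal +
      (dContent n δ (Q.toSet ∩ {x | f x < 0})).toReal)

section Helpers

variable {n : ℕ} {δ : ℝ}

lemma hc_mono {A B : Set (Fin n → ℝ)} (h : A ⊆ B) : hContent n δ A ≤ hContent n δ B := by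
  unfold hContent
  refine le_iInf fun Qs => le_iInf fun hB => ?_
  exact iInf₂_le Qs (h.trans hB)

lemma exists_cube_side (n : ℕ) (hδ : 0 < δ) (e : NNReal) (he : 0 < e) :
    ∃ Q : Cube n, ENNReal.ofReal (Q.side ^ δ) = e := by
  have he' : (0:ℝ) < e := by exact_mod_cast he
  refine ⟨⟨0, (e:ℝ) ^ (1/δ), by positivity⟩, ?_⟩
  simp only
  rw [← Real.rpow_mul he'.le, one_div, inv_mul_cancel₀ hδ.ne', Real.rpow_one,
    ENNReal.ofReal_coe_nnreal]

lemma hc_empty (hδ : 0 < δ) : hContent n δ ∅ = 0 := by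
  refine le_antisymm (ENNReal.le_of_forall_pos_le_add fun e he _ => ?_) bot_le
  obtain ⟨e', h1, h2⟩ := ENNReal.exists_pos_sum_of_countable
    (ε := (e:ℝ≥0∞)) (by exact_mod_cast he.ne') ℕ
  choose Q hQ using fun i => exists_cube_side n hδ (e' i) (h1 i)
  unfold hContent
  refine (iInf₂_le Q (empty_subset _)).trans ?_
  simp only [hQ, zero_add]
  exact h2.le

lemma hc_cube_le (hδ : 0 < δ) (Q : Cube n) :
    hContent n δ Q.toSet ≤ ENNReal.ofReal (Q.side ^ δ) := by
  refine ENNReal.le_of_forall_pos_le_add fun e he _ => ?_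
  obtain ⟨e', h1, h2⟩ := ENNReal.exists_pos_sum_of_countable
    (ε := (e:ℝ≥0∞)) (by exact_mod_cast he.ne') ℕ
  choose R hR using fun i => exists_cube_side n hδ (e' i) (h1 i)
  let S : ℕ → Cube n := fun i => Nat.casesOn i Q R
  unfold hContent
  refine (iInf₂_le S ?_).trans ?_
  · exact subset_iUnion (fun i => (S i).toSet) 0
  · rw [tsum_eq_zero_add' ENNReal.summable]
    simp only [S, hR]
    exact add_le_add le_rfl h2.le

lemma hc_iUnion_nat (E : ℕ → Set (Fin n → ℝ)) :
    hContent n δ (⋃ i, E i) ≤ ∑' i, hContent n δ (E i) := by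
  refine ENNReal.le_of_forall_pos_le_add fun e he hfin => ?_
  obtain ⟨e', h1, h2⟩ := ENNReal.exists_pos_sum_of_countable
    (ε := (e:ℝ≥0∞)) (by exact_mod_cast he.ne') ℕ
  have key : ∀ i, ∃ Qs : ℕ → Cube n, E i ⊆ ⋃ j, (Qs j).toSet ∧
      ∑' j, ENNReal.ofReal ((Qs j).side ^ δ) ≤ hContent n δ (E i) + e' i := by
    intro i
    have hlt : hContent n δ (E i) < hContent n δ (E i) + e' i :=
      ENNReal.lt_add_right (ENNReal.ne_top_of_tsum_ne_top hfin.ne i)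
        (by exact_mod_cast (h1 i).ne')
    conv_lhs at hlt => unfold hContent
    simp only [iInf_lt_iff] at hlt
    obtain ⟨Qs, hs, hlt⟩ := hlt
    exact ⟨Qs, hs, hlt.le⟩
  choose Qs hs hle using key
  have : hContent n δ (⋃ i, E i) ≤
      ∑' k, ENNReal.ofReal ((Qs (Nat.unpair k).1 (Nat.unpair k).2).side ^ δ) := by
    conv_lhs => unfold hContent
    refine iInf₂_le (fun k => Qs (Nat.unpair k).1 (Nat.unpair k).2) ?_
    intro x hx
    obtain ⟨i, hi⟩ := mem_iUnion.1 hx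
    obtain ⟨j, hj⟩ := mem_iUnion.1 (hs i hi)
    refine mem_iUnion.2 ⟨Nat.pair i j, ?_⟩
    simpa using hj
  refine this.trans ?_
  rw [← Nat.pairEquiv.tsum_eq]
  simp only [Nat.pairEquiv_apply, Function.uncurry, Nat.unpair_pair]
  rw [ENNReal.tsum_prod']
  calc _ ≤ ∑' i, (hContent n δ (E i) + e' i) := ENNReal.tsum_le_tsum fun i => hle i
    _ = _ := ENNReal.tsum_add
    _ ≤ _ := by gcongr

/-- The Hausdorff content as an outer measure. -/
def hOM (n : ℕ) (δ : ℝ) (hδ : 0 < δ) : OuterMeasure (Fin n → ℝ) where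
  measureOf := hContent n δ
  empty := hc_empty hδ
  mono h := hc_mono h
  iUnion_nat s _ := hc_iUnion_nat s

lemma hOM_apply (hδ : 0 < δ) (E : Set (Fin n → ℝ)) : hOM n δ hδ E = hContent n δ E := rfl

lemma hc_iUnion (hδ : 0 < δ) {ι : Type*} [Countable ι] (E : ι → Set (Fin n → ℝ)) :
    hContent n δ (⋃ i, E i) ≤ ∑' i, hContent n δ (E i) :=
  measure_iUnion_le (μ := hOM n δ hδ) E

lemma hc_iUnion_null (hδ : 0 < δ) {ι : Type*} [Countable ι] (E : ι → Set (Fin n → ℝ))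
    (h : ∀ i, hContent n δ (E i) = 0) : hContent n δ (⋃ i, E i) = 0 :=
  measure_iUnion_null (μ := hOM n δ hδ) h

lemma hc_union (hδ : 0 < δ) (A B : Set (Fin n → ℝ)) :
    hContent n δ (A ∪ B) ≤ hContent n δ A + hContent n δ B :=
  measure_union_le (μ := hOM n δ hδ) A B

lemma vol_cube (Q : Cube n) : volume Q.toSet = ENNReal.ofReal (Q.side ^ (n:ℝ)) := by
  have : Q.toSet = Set.univ.pi fun i => Set.Ico (Q.corner i) (Q.corner i + Q.side) := by
    ext x; simp [Cube.toSet]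
  rw [this, Real.volume_pi_Ico]
  simp [ENNReal.ofReal_pow Q.side_pos.le]

lemma hc_cube_ge (hδn : δ ≤ n) (hδ : 0 < δ) (Q : Cube n) :
    ENNReal.ofReal (Q.side ^ δ) ≤ hContent n δ Q.toSet := by
  unfold hContent
  refine le_iInf fun Qs => le_iInf fun hs => ?_
  by_cases hex : ∃ i, Q.side ≤ (Qs i).side
  · obtain ⟨i, hi⟩ := hex
    refine le_trans ?_ (ENNReal.le_tsum i)
    exact ENNReal.ofReal_le_ofReal (Real.rpow_le_rpow Q.side_pos.le hi hδ.le)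
  · push Not at hex
    have hQ := Q.side_pos
    have h1 : ENNReal.ofReal (Q.side ^ (n:ℝ)) ≤
        ∑' i, ENNReal.ofReal ((Qs i).side ^ (n:ℝ)) := by
      rw [← vol_cube]
      refine (measure_mono hs).trans ((measure_iUnion_le _).trans ?_)
      simp only [vol_cube, le_refl]
    have h2 : ∀ i, ENNReal.ofReal ((Qs i).side ^ (n:ℝ)) ≤
        ENNReal.ofReal (Q.side ^ ((n:ℝ) - δ)) * ENNReal.ofReal ((Qs i).side ^ δ) := by
      intro i
      have hi := (Qs i).side_pos
      rw [← ENNReal.ofReal_mul (by positivity)]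
      apply ENNReal.ofReal_le_ofReal
      have : (Qs i).side ^ (n:ℝ) = (Qs i).side ^ ((n:ℝ) - δ) * (Qs i).side ^ δ := by
        rw [← Real.rpow_add hi]; ring_nf
      rw [this]
      gcongr
      exact (hex i).le
    have h3 := h1.trans (ENNReal.tsum_le_tsum h2)
    rw [ENNReal.tsum_mul_left] at h3
    have : Q.side ^ (n:ℝ) = Q.side ^ ((n:ℝ) - δ) * Q.side ^ δ := by
      rw [← Real.rpow_add hQ]; ring_nf
    rw [this, ENNReal.ofReal_mul (by positivity)] at h3
    exact (ENNReal.mul_le_mul_iff_right (by simp; positivity) ENNReal.ofReal_ne_top).1 h3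

lemma hc_cube (hδn : δ ≤ n) (hδ : 0 < δ) (Q : Cube n) :
    hContent n δ Q.toSet = ENNReal.ofReal (Q.side ^ δ) :=
  le_antisymm (hc_cube_le hδ Q) (hc_cube_ge hδn hδ Q)

/-- Inside a cube `Q`, near a point of `Q` there is a cube of any smaller side. -/
lemma exists_clamped (Q : Cube n) (x : Fin n → ℝ) (hx : x ∈ Q.toSet) (ρ : ℝ) (h0 : 0 < ρ)
    (hρ : ρ ≤ Q.side) :
    ∃ R : Cube n, R.side = ρ ∧ R.toSet ⊆ Q.toSet ∧
      ∀ y ∈ R.toSet, ∀ i, x i - ρ ≤ y i ∧ y i < x i + ρ := by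
  refine ⟨⟨fun i => min (x i) (Q.corner i + Q.side - ρ), ρ, h0⟩, rfl, ?_, ?_⟩
  · intro y hy i
    have h1 := hy i
    have h2 := hx i
    simp only at h1
    rcases min_cases (x i) (Q.corner i + Q.side - ρ) with h | h <;> constructor <;> linarith
  · intro y hy i
    have h1 := hy i
    have h2 := hx i
    simp only at h1
    rcases min_cases (x i) (Q.corner i + Q.side - ρ) with h | h <;> constructor <;> linarith

lemma dist_le_of_cube (Q : Cube n) {x y : Fin n → ℝ} (hx : x ∈ Q.toSet) (hy : y ∈ Q.toSet) :
    dist x y ≤ Q.side := by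
  rw [dist_pi_le_iff Q.side_pos.le]
  intro i
  have h1 := hx i
  have h2 := hy i
  rw [Real.dist_eq, abs_le]
  constructor <;> linarith

/-- The key covering lemma. -/
lemma covering (hδn : δ ≤ n) (hδ : 0 < δ) (Q : Cube n) (E : Set (Fin n → ℝ)) (hEQ : E ⊆ Q.toSet)
    (hE : hContent n δ E < ENNReal.ofReal ((1/2) * (1/24) ^ δ * Q.side ^ δ)) :
    ∃ (u : Set ℕ) (P : ℕ → Cube n), E ⊆ (⋃ j : u, (P j).toSet) ∧
      (∑' j : u, ENNReal.ofReal ((P j).side ^ δ) ≤ ENNReal.ofReal ((1/2) * Q.side ^ δ)) ∧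
      ∀ j ∈ u, 0 < hContent n δ {x | x ∈ (P j).toSet ∧ x ∈ Q.toSet ∧ x ∉ E} := by
  have hQ := Q.side_pos
  conv_lhs at hE => unfold hContent
  simp only [iInf_lt_iff] at hE
  obtain ⟨Qs, hcov, hsum⟩ := hE
  set a : ℕ → ℝ≥0∞ := fun i => ENNReal.ofReal ((Qs i).side ^ δ) with ha
  let I : Set ℕ := {i | ((Qs i).toSet ∩ E).Nonempty}
  have hxex : ∀ i, ∃ x : Fin n → ℝ, i ∈ I → x ∈ (Qs i).toSet ∧ x ∈ E := by
    intro i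
    by_cases hi : i ∈ I
    · obtain ⟨x, hx⟩ := hi
      exact ⟨x, fun _ => hx⟩
    · exact ⟨0, fun h => absurd h hi⟩
  choose x hx using hxex
  let μ : Measure (Fin n → ℝ) := Measure.sum fun i : I => a i • Measure.dirac (x i)
  have hμ : ∀ S : Set (Fin n → ℝ), MeasurableSet S →
      μ S = ∑' i : I, S.indicator (fun _ => a i) (x i) := by
    intro S hS
    simp only [μ]
    rw [Measure.sum_apply _ hS]
    congr 1
    ext i
    rw [Measure.smul_apply, Measure.dirac_apply' _ hS]
    by_cases h : x i ∈ S <;> simp [h]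
  have hμuniv : μ univ < ENNReal.ofReal ((1/2) * (1/24) ^ δ * Q.side ^ δ) := by
    rw [hμ _ MeasurableSet.univ]
    refine lt_of_le_of_lt ?_ hsum
    simp only [indicator_univ]
    exact ENNReal.tsum_comp_le_tsum_of_injective Subtype.val_injective a
  have hμge : ∀ S : Set (Fin n → ℝ), MeasurableSet S → ∀ i ∈ I, x i ∈ S → a i ≤ μ S := by
    intro S hS i hi hxi
    rw [hμ S hS]
    refine le_trans ?_ (ENNReal.le_tsum (⟨i, hi⟩ : I))
    simp [hxi]
  let η : ℝ := (1/2) ^ δ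
  have hη0 : 0 < η := by positivity
  have hη1 : η ≤ 1 := Real.rpow_le_one (by norm_num) (by norm_num) hδ.le
  let T : ℕ → Set ℝ := fun i => {r | 0 < r ∧ ENNReal.ofReal (η * r ^ δ) ≤ μ (Metric.closedBall (x i) r)}
  have hTle : ∀ i, ∀ r ∈ T i, 6 * r ≤ Q.side := by
    intro i r hr
    by_contra hcon
    push Not at hcon
    have h1 := hr.2.trans_lt ((measure_mono (subset_univ _)).trans_lt hμuniv)
    have h2 := (ENNReal.ofReal_lt_ofReal_iff_of_nonneg (by have := hr.1; positivity)).1 h1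
    have h3 : (Q.side / 6) ^ δ ≤ r ^ δ :=
      Real.rpow_le_rpow (by positivity) (by linarith) hδ.le
    have h4 : (1/2:ℝ) * (1/24) ^ δ * Q.side ^ δ ≤ η * (Q.side/6) ^ δ := by
      have e1 : (Q.side/6) ^ δ = (1/6:ℝ) ^ δ * Q.side ^ δ := by
        rw [← Real.mul_rpow (by norm_num) hQ.le]; ring_nf
      have e2 : η * (1/6:ℝ) ^ δ = (1/12) ^ δ := by
        rw [← Real.mul_rpow (by norm_num) (by norm_num)]; norm_num
      rw [e1, ← mul_assoc, e2]
      have e3 : (1/24:ℝ) ^ δ ≤ (1/12) ^ δ :=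
        Real.rpow_le_rpow (by norm_num) (by norm_num) hδ.le
      have e4 : (0:ℝ) < (1/24) ^ δ := by positivity
      gcongr
      linarith
    have h5 : η * (Q.side/6) ^ δ ≤ η * r ^ δ := by gcongr
    linarith
  have hTmem : ∀ i ∈ I, (Qs i).side ∈ T i := by
    intro i hi
    refine ⟨(Qs i).side_pos, ?_⟩
    refine le_trans ?_ (hμge _ Metric.isClosed_closedBall.measurableSet i hi
      (Metric.mem_closedBall_self (Qs i).side_pos.le))
    apply ENNReal.ofReal_le_ofReal
    have : 0 < (Qs i).side ^ δ := Real.rpow_pos_of_pos (Qs i).side_pos δ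
    nlinarith
  have hrex : ∀ i, ∃ r : ℝ, i ∈ I → r ∈ T i ∧ (Qs i).side ≤ r ∧ ∀ s, 2 * r ≤ s → s ∉ T i := by
    intro i
    by_cases hi : i ∈ I
    swap
    · exact ⟨0, fun h => absurd h hi⟩
    have hne : (T i).Nonempty := ⟨_, hTmem i hi⟩
    have hbd : BddAbove (T i) := ⟨Q.side / 6, fun r hr => by have := hTle i r hr; linarith⟩
    have hpos : 0 < sSup (T i) := lt_of_lt_of_le (Qs i).side_pos (le_csSup hbd (hTmem i hi))
    obtain ⟨r', hr', hlt⟩ := exists_lt_of_lt_csSup hne (half_lt_self hpos)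
    rcases le_total (Qs i).side r' with h | h
    · refine ⟨r', fun _ => ⟨hr', h, fun s hs hsT => ?_⟩⟩
      have := le_csSup hbd hsT
      linarith
    · refine ⟨(Qs i).side, fun _ => ⟨hTmem i hi, le_rfl, fun s hs hsT => ?_⟩⟩
      have := le_csSup hbd hsT
      linarith
  choose r hr using hrex
  obtain ⟨u, huI, hdisj, hcovu⟩ := Vitali.exists_disjoint_subfamily_covering_enlargement_closedBall
    I x r (Q.side / 6) (fun i hi => by have := hTle i _ (hr i hi).1; linarith) 5 (by norm_num)
  have hex : ∀ j, ∃ P : Cube n, j ∈ u → P.side = 12 * r j ∧ ∀ i, P.corner i = x j i - 6 * r j := by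
    intro j
    by_cases hj : j ∈ u
    · have h0 := (hr j (huI hj)).1.1
      exact ⟨⟨fun i => x j i - 6 * r j, 12 * r j, by positivity⟩, fun _ => ⟨rfl, fun _ => rfl⟩⟩
    · exact ⟨⟨0, 1, one_pos⟩, fun h => absurd h hj⟩
  choose P hP using hex
  refine ⟨u, P, ?_, ?_, ?_⟩
  · intro y hy
    obtain ⟨i, hi⟩ := mem_iUnion.1 (hcov hy)
    have hiI : i ∈ I := ⟨y, hi, hy⟩
    obtain ⟨j, hj, hsub⟩ := hcovu i hiI
    have hyb : y ∈ Metric.closedBall (x j) (5 * r j) := by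
      apply hsub
      rw [Metric.mem_closedBall]
      exact (dist_le_of_cube _ hi (hx i hiI).1).trans (hr i hiI).2.1
    refine mem_iUnion.2 ⟨⟨j, hj⟩, ?_⟩
    have h0 := (hr j (huI hj)).1.1
    intro k
    obtain ⟨p1, p2⟩ := hP j hj
    rw [p1, p2]
    have := (dist_le_pi_dist y (x j) k).trans (Metric.mem_closedBall.1 hyb)
    rw [Real.dist_eq, abs_le] at this
    constructor <;> linarith
  · have hle : ∀ j : u, ENNReal.ofReal ((P j).side ^ δ) ≤
        ENNReal.ofReal (24 ^ δ) * μ (Metric.closedBall (x j) (r j)) := by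
      intro j
      have hrj := (hr j (huI j.2)).1
      have h0 := hrj.1
      rw [(hP j j.2).1]
      refine le_trans ?_ (mul_le_mul_right hrj.2 _)
      rw [← ENNReal.ofReal_mul (by positivity)]
      apply ENNReal.ofReal_le_ofReal
      rw [← mul_assoc, ← Real.mul_rpow (by norm_num) (by norm_num),
        ← Real.mul_rpow (by norm_num) h0.le]
      norm_num
    refine (ENNReal.tsum_le_tsum hle).trans ?_
    rw [ENNReal.tsum_mul_left]
    have h1 : ∑' j : u, μ (Metric.closedBall (x j) (r j)) ≤ μ univ := by
      refine (tsum_meas_le_meas_iUnion_of_disjoint μ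
        (fun _ => Metric.isClosed_closedBall.measurableSet) ?_).trans (measure_mono (subset_univ _))
      intro i j hij
      exact hdisj i.2 j.2 (fun h => hij (Subtype.ext h))
    refine (mul_le_mul_right (h1.trans hμuniv.le) _).trans ?_
    rw [← ENNReal.ofReal_mul (by positivity)]
    apply ENNReal.ofReal_le_ofReal
    have e : (24:ℝ) ^ δ * (1/24) ^ δ = 1 := by
      rw [← Real.mul_rpow (by norm_num) (by norm_num)]; norm_num
    apply le_of_eq
    linear_combination (1/2 * Q.side ^ δ) * e
  · intro j hj
    have hjI := huI hj
    obtain ⟨hrT, hrs, hrbig⟩ := hr j hjI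
    have h0 := hrT.1
    obtain ⟨p1, p2⟩ := hP j hj
    have hsmall : ∀ s, 2 * r j ≤ s → μ (Metric.closedBall (x j) s) < ENNReal.ofReal (η * s ^ δ) := by
      intro s hs
      have := hrbig s hs
      by_contra hcon
      exact this ⟨by linarith, not_lt.1 hcon⟩
    have h6 : 6 * r j ≤ Q.side := hTle j _ hrT
    obtain ⟨R, hR1, hR2, hR3⟩ := exists_clamped Q (x j) (hEQ (hx j hjI).2) (6 * r j) (by positivity) h6
    have hRP : R.toSet ⊆ (P j).toSet := by
      intro y hy k
      have := hR3 y hy k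
      rw [p1, p2]
      constructor <;> linarith
    have hEP : hContent n δ (E ∩ (P j).toSet) ≤ μ (Metric.closedBall (x j) (12 * r j)) := by
      have hsub : E ∩ (P j).toSet ⊆
          ⋃ i : I, {y | x i ∈ Metric.closedBall (x j) (12 * r j) ∧ y ∈ (Qs i).toSet} := by
        rintro y ⟨hyE, hyP⟩
        obtain ⟨i, hi⟩ := mem_iUnion.1 (hcov hyE)
        have hiI : i ∈ I := ⟨y, hi, hyE⟩
        refine mem_iUnion.2 ⟨⟨i, hiI⟩, ?_, hi⟩
        have d1 : dist (x i) y ≤ (Qs i).side := dist_le_of_cube _ (hx i hiI).1 hi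
        have d2 : dist y (x j) ≤ 6 * r j := by
          rw [dist_pi_le_iff (by positivity)]
          intro k
          have := hyP k
          rw [p1, p2] at this
          rw [Real.dist_eq, abs_le]
          constructor <;> linarith
        have d3 := dist_triangle (x i) y (x j)
        rw [Metric.mem_closedBall]
        rcases le_or_gt (Qs i).side (6 * r j) with h | h
        · linarith
        · exfalso
          have hmem : x i ∈ Metric.closedBall (x j) (2 * (Qs i).side) := by
            rw [Metric.mem_closedBall]; linarith
          have e1 := (hμge _ Metric.isClosed_closedBall.measurableSet i hiI hmem).trans_lt
            (hsmall _ (by linarith))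
          have e2 : η * (2 * (Qs i).side) ^ δ = (Qs i).side ^ δ := by
            rw [← Real.mul_rpow (by norm_num) (by have := (Qs i).side_pos; positivity)]
            ring_nf
          rw [e2] at e1
          exact lt_irrefl _ e1
      refine (hc_mono hsub).trans ((hc_iUnion hδ _).trans ?_)
      rw [hμ _ Metric.isClosed_closedBall.measurableSet]
      refine ENNReal.tsum_le_tsum fun i => ?_
      by_cases h : x i ∈ Metric.closedBall (x j) (12 * r j)
      · rw [indicator_of_mem h]
        refine (hc_mono ?_).trans (hc_cube_le hδ (Qs i))
        exact fun y hy => hy.2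
      · have : {y | x i ∈ Metric.closedBall (x j) (12 * r j) ∧ y ∈ (Qs i).toSet} = ∅ := by
          ext y; simp only [h, false_and, mem_ofPred_eq, mem_empty_iff_false]
        rw [this, hc_empty hδ]
        exact zero_le
    by_contra hcon
    have hzero := le_antisymm (not_lt.1 hcon) zero_le
    have h1 : hContent n δ R.toSet ≤ hContent n δ (E ∩ (P j).toSet) := by
      have hs : R.toSet ⊆ (E ∩ (P j).toSet) ∪ {x | x ∈ (P j).toSet ∧ x ∈ Q.toSet ∧ x ∉ E} := by
        intro y hy
        by_cases hyE : y ∈ E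
        · exact Or.inl ⟨hyE, hRP hy⟩
        · exact Or.inr ⟨hRP hy, hR2 hy, hyE⟩
      have := (hc_mono (δ := δ) hs).trans (hc_union hδ _ _)
      rwa [hzero, add_zero] at this
    have h2 := h1.trans_lt (hEP.trans_lt (hsmall (12 * r j) (by linarith)))
    rw [hc_cube hδn hδ, hR1] at h2
    have e2 : η * (12 * r j) ^ δ = (6 * r j) ^ δ := by
      rw [← Real.mul_rpow (by norm_num) (by positivity)]
      ring_nf
    rw [e2] at h2
    exact lt_irrefl _ h2

lemma integH_ge (g : (Fin n → ℝ) → ℝ) (S E : Set (Fin n → ℝ)) (s : ℝ)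
    (h : ∀ x ∈ E, x ∈ S ∧ s ≤ g x) :
    ENNReal.ofReal s * hContent n δ E ≤ integH n δ g S := by
  unfold integH
  calc ENNReal.ofReal s * hContent n δ E = ∫⁻ _ in Ioo (0:ℝ) s, hContent n δ E := by
        rw [setLIntegral_const, Real.volume_Ioo, sub_zero, mul_comm]
    _ ≤ ∫⁻ t in Ioo (0:ℝ) s, hContent n δ {x | x ∈ S ∧ t < g x} := by
        refine setLIntegral_mono' measurableSet_Ioo fun t ht => hc_mono ?_
        intro x hx
        exact ⟨(h x hx).1, ht.2.trans_le (h x hx).2⟩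
    _ ≤ _ := lintegral_mono_set Ioo_subset_Ioi_self

lemma integH_mono_set (g : (Fin n → ℝ) → ℝ) {S S' : Set (Fin n → ℝ)} (h : S ⊆ S') :
    integH n δ g S ≤ integH n δ g S' := by
  unfold integH
  exact lintegral_mono fun t => hc_mono fun x hx => ⟨h hx.1, hx.2⟩

lemma essInfQ_nonneg (f : (Fin n → ℝ) → ℝ) (Q : Cube n) : 0 ≤ essInfQ n δ f Q :=
  Real.sInf_nonneg fun _ ht => ht.1.le

lemma essInfQ_le (f : (Fin n → ℝ) → ℝ) (Q : Cube n) (v : ℝ) (hv : 0 ≤ v)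
    (h : 0 < hContent n δ {x | x ∈ Q.toSet ∧ f x ≤ v}) : essInfQ n δ f Q ≤ v := by
  refine le_of_forall_gt_imp_ge_of_dense fun t ht => ?_
  refine csInf_le ⟨0, fun _ hs => hs.1.le⟩ ⟨hv.trans_lt ht, h.trans_le (hc_mono ?_)⟩
  exact fun x hx => ⟨hx.1, hx.2.trans_lt ht⟩

lemma essInfQ_null (hδ : 0 < δ) (f : (Fin n → ℝ) → ℝ) (Q : Cube n) (hpos : 0 < essInfQ n δ f Q) :
    hContent n δ {x | x ∈ Q.toSet ∧ f x < essInfQ n δ f Q} = 0 := by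
  have hnull : ∀ q : ℚ, hContent n δ
      {x | (0 < (q:ℝ) ∧ (q:ℝ) < essInfQ n δ f Q) ∧ x ∈ Q.toSet ∧ f x < q} = 0 := by
    intro q
    by_cases hq : 0 < (q:ℝ) ∧ (q:ℝ) < essInfQ n δ f Q
    · by_contra hne
      have : essInfQ n δ f Q ≤ q := by
        refine csInf_le ⟨0, fun _ hs => hs.1.le⟩ ⟨hq.1, (pos_iff_ne_zero.2 hne).trans_le (hc_mono ?_)⟩
        exact fun x hx => hx.2
      linarith [hq.2]
    · refine le_antisymm ?_ zero_le
      rw [← hc_empty (n := n) hδ]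
      exact hc_mono fun x hx => hq hx.1
  refine le_antisymm ?_ zero_le
  rw [← hc_iUnion_null hδ _ hnull]
  refine hc_mono fun x hx => ?_
  obtain ⟨q, hq1, hq2⟩ := exists_rat_btwn (max_lt hx.2 hpos)
  refine mem_iUnion.2 ⟨q, ⟨(le_max_right _ _).trans_lt hq1, hq2⟩, hx.1, (le_max_left _ _).trans_lt hq1⟩

/-- A set of positive finite content has large content in some cube. -/
lemma exists_dense_cube (hδ : 0 < δ) (G : Set (Fin n → ℝ)) (h0 : 0 < hContent n δ G)
    (hfin : hContent n δ G ≠ ⊤) :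
    ∃ R : Cube n, ENNReal.ofReal (R.side ^ δ) ≤ 2 * hContent n δ (G ∩ R.toSet) := by
  have hlt : hContent n δ G < 2 * hContent n δ G := by
    rw [two_mul]; exact ENNReal.lt_add_right hfin h0.ne'
  conv_lhs at hlt => unfold hContent
  simp only [iInf_lt_iff] at hlt
  obtain ⟨Qs, hs, hlt⟩ := hlt
  by_contra hcon
  push Not at hcon
  have h1 : hContent n δ G ≤ ∑' i, hContent n δ (G ∩ (Qs i).toSet) := by
    refine (hc_mono ?_).trans (hc_iUnion hδ _)
    rw [← inter_iUnion]
    exact subset_inter subset_rfl hs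
  have h2 : 2 * ∑' i, hContent n δ (G ∩ (Qs i).toSet) ≤
      ∑' i, ENNReal.ofReal ((Qs i).side ^ δ) := by
    rw [← ENNReal.tsum_mul_left]
    exact ENNReal.tsum_le_tsum fun i => (hcon _).le
  exact absurd ((mul_le_mul_right h1 2).trans h2) (not_le.2 hlt)

/-- The standing BLO estimate. -/
def BLOBd (n : ℕ) (δ : ℝ) (f : (Fin n → ℝ) → ℝ) (B : ℝ) : Prop :=
  ∀ Q : Cube n, integH n δ (fun x => |f x - essInfQ n δ f Q|) Q.toSet ≤
    ENNReal.ofReal (B * Q.side ^ δ)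

lemma lower_bd (hδ : 0 < δ) (f : (Fin n → ℝ) → ℝ) (B : ℝ) (hB : 0 < B)
    (hf : BLOBd n δ f B) : hContent n δ {x | f x < -(3 * B)} = 0 := by
  have hnull : ∀ N : ℕ, hContent n δ
      {x | f x < -(3 * B) ∧ ∀ i, -(N:ℝ) - 1 ≤ x i ∧ x i < N + 1} = 0 := by
    intro N
    by_contra hne
    have hfin : hContent n δ {x | f x < -(3 * B) ∧ ∀ i, -(N:ℝ) - 1 ≤ x i ∧ x i < N + 1} ≠ ⊤ := by
      let R : Cube n := ⟨fun _ => -(N:ℝ) - 1, 2 * N + 2, by positivity⟩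
      refine ((hc_mono ?_).trans_lt ((hc_cube_le hδ R).trans_lt ENNReal.ofReal_lt_top)).ne
      intro x hx i
      have := hx.2 i
      simp only [R]
      constructor <;> linarith
    obtain ⟨R, hR⟩ := exists_dense_cube hδ _ (pos_iff_ne_zero.2 hne) hfin
    have hRs := R.side_pos
    set G := {x | f x < -(3 * B) ∧ ∀ i, -(N:ℝ) - 1 ≤ x i ∧ x i < N + 1} ∩ R.toSet with hG
    have hGpos : 0 < hContent n δ G := by
      by_contra h
      have := le_antisymm (not_lt.1 h) zero_le
      rw [this, mul_zero] at hR
      have hp : 0 < R.side ^ δ := by positivity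
      exact absurd hR (not_le.2 (ENNReal.ofReal_pos.2 hp))
    have hm : essInfQ n δ f R = 0 := by
      refine le_antisymm (essInfQ_le f R 0 le_rfl (hGpos.trans_le (hc_mono ?_))) (essInfQ_nonneg f R)
      intro x hx
      exact ⟨hx.2, by have := hx.1.1; linarith⟩
    have h1 := hf R
    rw [hm] at h1
    have h2 := (integH_ge (δ := δ) (fun x => |f x - 0|) R.toSet G (3 * B) (by
      intro x hx
      refine ⟨hx.2, ?_⟩
      have := hx.1.1
      rw [sub_zero, abs_of_nonpos (by linarith)]
      linarith)).trans h1
    have h3 : ENNReal.ofReal (3 * B) * ENNReal.ofReal (R.side ^ δ) ≤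
        2 * ENNReal.ofReal (B * R.side ^ δ) := by
      calc _ ≤ ENNReal.ofReal (3 * B) * (2 * hContent n δ G) := by gcongr
        _ = 2 * (ENNReal.ofReal (3 * B) * hContent n δ G) := by ring
        _ ≤ _ := by gcongr
    have e2 : (2:ℝ≥0∞) = ENNReal.ofReal 2 := by simp
    have hp : 0 < R.side ^ δ := by positivity
    rw [e2, ← ENNReal.ofReal_mul (by positivity), ← ENNReal.ofReal_mul (by positivity),
      ENNReal.ofReal_le_ofReal_iff (by positivity)] at h3
    nlinarith [mul_pos hB hp]
  refine le_antisymm ?_ zero_le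
  rw [← hc_iUnion_null hδ _ hnull]
  refine hc_mono ?_
  intro x hx
  obtain ⟨N, hN⟩ := exists_nat_ge ‖x‖
  refine mem_iUnion.2 ⟨N, hx, fun i => ?_⟩
  have := abs_le.1 ((norm_le_pi_norm x i).trans hN)
  constructor <;> linarith

/-- The John–Nirenberg inequality. -/
lemma john_nirenberg (hδn : δ ≤ n) (hδ : 0 < δ) (f : (Fin n → ℝ) → ℝ) (B : ℝ) (hB : 0 < B)
    (hf : BLOBd n δ f B) (k : ℕ) : ∀ Q : Cube n,
    hContent n δ {x | x ∈ Q.toSet ∧ essInfQ n δ f Q + k * (4 * 24 ^ δ * B) < f x} ≤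
      ENNReal.ofReal ((1/2) ^ k * Q.side ^ δ) := by
  induction k with
  | zero =>
    intro Q
    simp only [pow_zero, one_mul]
    exact (hc_mono fun x hx => hx.1).trans (hc_cube_le hδ Q)
  | succ k ih =>
    intro Q
    have hQ := Q.side_pos
    set s : ℝ := 4 * 24 ^ δ * B with hs
    have hs0 : 0 < s := by positivity
    set m := essInfQ n δ f Q with hm
    have hm0 : 0 ≤ m := essInfQ_nonneg f Q
    let E := {x | x ∈ Q.toSet ∧ m + s < f x}
    have hE : hContent n δ E < ENNReal.ofReal ((1/2) * (1/24) ^ δ * Q.side ^ δ) := by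
      have h1 := (integH_ge (δ := δ) (fun x => |f x - m|) Q.toSet E s (by
        intro x hx
        refine ⟨hx.1, le_trans ?_ (le_abs_self _)⟩
        have := hx.2
        linarith)).trans (hf Q)
      by_contra hcon
      push Not at hcon
      have h2 := (mul_le_mul_right hcon (ENNReal.ofReal s)).trans h1
      rw [← ENNReal.ofReal_mul hs0.le, ENNReal.ofReal_le_ofReal_iff (by positivity)] at h2
      have e : (24:ℝ) ^ δ * (1/24) ^ δ = 1 := by
        rw [← Real.mul_rpow (by norm_num) (by norm_num)]; norm_num
      have e2 : s * (1 / 2 * (1 / 24) ^ δ * Q.side ^ δ) = 2 * (B * Q.side ^ δ) := by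
        rw [hs]
        linear_combination (2 * B * Q.side ^ δ) * e
      rw [e2] at h2
      have : 0 < B * Q.side ^ δ := by positivity
      linarith
    obtain ⟨u, P, hcov, hsum, hpos⟩ := covering hδn hδ Q E (fun x hx => hx.1) hE
    have hmP : ∀ j ∈ u, essInfQ n δ f (P j) ≤ m + s := by
      intro j hj
      refine essInfQ_le f _ _ (by linarith) ((hpos j hj).trans_le (hc_mono ?_))
      intro x hx
      refine ⟨hx.1, ?_⟩
      by_contra hcon
      exact hx.2.2 ⟨hx.2.1, not_le.1 hcon⟩
    have hsub : {x | x ∈ Q.toSet ∧ m + ((k + 1 : ℕ) : ℝ) * s < f x} ⊆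
        ⋃ j : u, {x | x ∈ (P j).toSet ∧ essInfQ n δ f (P j) + k * s < f x} := by
      intro x hx
      have hx2 := hx.2
      push_cast at hx2
      have hk : 0 ≤ (k:ℝ) * s := by positivity
      obtain ⟨j, hj⟩ := mem_iUnion.1 (hcov (⟨hx.1, by linarith⟩ : x ∈ E))
      refine mem_iUnion.2 ⟨j, hj, ?_⟩
      have := hmP j j.2
      linarith
    calc _ ≤ ∑' j : u, ENNReal.ofReal ((1/2) ^ k * (P j).side ^ δ) :=
          (hc_mono hsub).trans ((hc_iUnion hδ _).trans (ENNReal.tsum_le_tsum fun j => ih (P j)))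
      _ = ENNReal.ofReal ((1/2) ^ k) * ∑' j : u, ENNReal.ofReal ((P j).side ^ δ) := by
          rw [← ENNReal.tsum_mul_left]
          congr 1
          ext j
          rw [ENNReal.ofReal_mul (by positivity)]
      _ ≤ ENNReal.ofReal ((1/2) ^ k) * ENNReal.ofReal ((1/2) * Q.side ^ δ) := by gcongr
      _ = _ := by
          rw [← ENNReal.ofReal_mul (by positivity)]
          ring_nf

lemma log_div_lemma (c A B f m τ : ℝ) (k : ℕ) (hc : 0 < c) (hB : 0 < B)
    (h : Real.exp (c * m / B) * Real.exp (c * A) ^ k ≤ τ) (hτ : τ < Real.exp (c * f / B)) :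
    m + k * (A * B) < f := by
  have h1 := h.trans_lt hτ
  rw [← Real.exp_nat_mul, ← Real.exp_add, Real.exp_lt_exp] at h1
  have h2 : c * m / B + k * (c * A) = c * (m + k * (A * B)) / B := by field_simp
  rw [h2, div_lt_div_iff_of_pos_right hB] at h1
  exact lt_of_mul_lt_mul_left h1 hc.le

lemma exp_avg (hδn : δ ≤ n) (hδ : 0 < δ) (f : (Fin n → ℝ) → ℝ) (B : ℝ) (hB : 0 < B)
    (hf : BLOBd n δ f B) (c : ℝ) (hc : 0 < c)
    (hcA : Real.exp (c * (4 * 24 ^ δ)) = Real.sqrt 2) (Q : Cube n) :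
    integH n δ (fun x => Real.exp (c * f x / B)) Q.toSet ≤
      ENNReal.ofReal (3 * Real.exp (c * essInfQ n δ f Q / B) * Q.side ^ δ) := by
  have hQ := Q.side_pos
  set m := essInfQ n δ f Q with hm
  set τ₀ := Real.exp (c * m / B) with hτ₀
  have h0 : 0 < τ₀ := Real.exp_pos _
  have hbig : ∀ τ ∈ Ioi τ₀, hContent n δ {x | x ∈ Q.toSet ∧ τ < Real.exp (c * f x / B)} ≤
      ENNReal.ofReal (2 * τ₀ ^ 2 * Q.side ^ δ * τ ^ (-2:ℝ)) := by
    intro τ hτ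
    have hτ : τ₀ < τ := hτ
    have hτp : 0 < τ := h0.trans hτ
    have hs2 : 1 < Real.sqrt 2 := by
      rw [Real.lt_sqrt (by norm_num)]; norm_num
    obtain ⟨k, hk1, hk2⟩ := exists_nat_pow_near (x := τ / τ₀) (by rw [le_div_iff₀ h0]; linarith) hs2
    have hsub : {x | x ∈ Q.toSet ∧ τ < Real.exp (c * f x / B)} ⊆
        {x | x ∈ Q.toSet ∧ m + k * (4 * 24 ^ δ * B) < f x} := by
      intro x hx
      refine ⟨hx.1, log_div_lemma c _ B _ _ τ k hc hB ?_ hx.2⟩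
      rw [hcA]
      rw [le_div_iff₀ h0] at hk1
      linarith
    refine (hc_mono hsub).trans ((john_nirenberg hδn hδ f B hB hf k Q).trans ?_)
    apply ENNReal.ofReal_le_ofReal
    have e1 : (1/2:ℝ) ^ k ≤ 2 * τ₀ ^ 2 * τ ^ (-2:ℝ) := by
      have e2 : (τ / τ₀) ^ 2 ≤ 2 ^ (k+1) := by
        calc (τ / τ₀) ^ 2 ≤ (Real.sqrt 2 ^ (k+1)) ^ 2 := by gcongr
          _ = 2 ^ (k+1) := by
            rw [← pow_mul, mul_comm, pow_mul, Real.sq_sqrt (by norm_num)]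
      rw [Real.rpow_neg hτp.le]
      norm_cast
      rw [div_pow, div_le_iff₀ (by positivity)] at e2
      rw [one_div, inv_pow, ← div_eq_mul_inv, inv_eq_one_div, div_le_div_iff₀ (by positivity) (by positivity)]
      rw [pow_succ (2:ℝ) k] at e2
      linarith
    have : 0 < Q.side ^ δ := by positivity
    nlinarith
  unfold integH
  have hsplit : Ioi (0:ℝ) = Ioc 0 τ₀ ∪ Ioi τ₀ := (Ioc_union_Ioi_eq_Ioi h0.le).symm
  rw [hsplit]
  refine (lintegral_union_le _ _ _).trans ?_
  have i1 : ∫⁻ τ in Ioc 0 τ₀, hContent n δ {x | x ∈ Q.toSet ∧ τ < Real.exp (c * f x / B)} ≤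
      ENNReal.ofReal (τ₀ * Q.side ^ δ) := by
    calc _ ≤ ∫⁻ _ in Ioc 0 τ₀, ENNReal.ofReal (Q.side ^ δ) :=
          lintegral_mono fun τ => (hc_mono fun x hx => hx.1).trans (hc_cube_le hδ Q)
      _ = _ := by
          rw [setLIntegral_const, Real.volume_Ioc, sub_zero, mul_comm, ENNReal.ofReal_mul h0.le]
  have i2 : ∫⁻ τ in Ioi τ₀, hContent n δ {x | x ∈ Q.toSet ∧ τ < Real.exp (c * f x / B)} ≤
      ENNReal.ofReal (2 * τ₀ * Q.side ^ δ) := by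
    refine (setLIntegral_mono' measurableSet_Ioi hbig).trans ?_
    rw [← ofReal_integral_eq_lintegral_ofReal]
    · rw [integral_const_mul, integral_Ioi_rpow_of_lt (by norm_num) h0]
      apply ENNReal.ofReal_le_ofReal
      have : (-2 + 1 : ℝ) = -1 := by norm_num
      rw [this, Real.rpow_neg_one]
      apply le_of_eq
      field_simp
    · exact (integrableOn_Ioi_rpow_of_lt (by norm_num) h0).const_mul _
    · refine (ae_restrict_iff' measurableSet_Ioi).2 (Filter.Eventually.of_forall fun τ hτ => ?_)
      have : 0 < τ := h0.trans hτ
      simp only [Pi.zero_apply]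
      positivity
  refine (add_le_add i1 i2).trans ?_
  rw [← ENNReal.ofReal_add (by positivity) (by positivity)]
  apply ENNReal.ofReal_le_ofReal
  apply le_of_eq
  ring

/-- Cubes with rational data. -/
def ratCube (n : ℕ) (p : (Fin n → ℚ) × {q : ℚ // 0 < q}) : Cube n :=
  ⟨fun i => p.1 i, (p.2 : ℚ), by exact_mod_cast p.2.2⟩

lemma exists_ratCube (Q : Cube n) : ∃ p, Q.toSet ⊆ (ratCube n p).toSet ∧
    (ratCube n p).side ≤ 2 * Q.side := by
  have hQ := Q.side_pos
  choose z hz1 hz2 using fun i => exists_rat_btwn (show Q.corner i - Q.side / 4 < Q.corner i by linarith)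
  obtain ⟨q, hq1, hq2⟩ := exists_rat_btwn (show 3 / 2 * Q.side < 2 * Q.side by linarith)
  have hq0 : (0:ℝ) < q := by linarith
  refine ⟨⟨z, ⟨q, by exact_mod_cast hq0⟩⟩, ?_, hq2.le⟩
  intro x hx i
  have := hx i
  have h1 := hz1 i
  have h2 := hz2 i
  simp only [ratCube]
  constructor <;> linarith

end Helpers

/-- exponentials of (normalized) BLO functions are A_{1,δ} weights. -/
theorem stmt3 (n : ℕ) (hn : 1 ≤ n) (δ : ℝ) (hδ0 : 0 < δ) (hδn : δ ≤ n) :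
    ∃ c : ℝ, 0 < c ∧ ∀ f : (Fin n → ℝ) → ℝ, MemBLO n δ f → bloNorm n δ f ≠ 0 →
      MemA1 n δ (fun x => Real.exp (c * f x / (bloNorm n δ f).toReal)) := by
  have hA : (0:ℝ) < 4 * 24 ^ δ := by positivity
  have hs2 : 1 < Real.sqrt 2 := by
    rw [Real.lt_sqrt (by norm_num)]; norm_num
  obtain ⟨c, hc, hcA⟩ : ∃ c : ℝ, 0 < c ∧ Real.exp (c * (4 * 24 ^ δ)) = Real.sqrt 2 := by
    refine ⟨Real.log (Real.sqrt 2) / (4 * 24 ^ δ), div_pos (Real.log_pos hs2) hA, ?_⟩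
    rw [div_mul_cancel₀ _ hA.ne', Real.exp_log (by linarith)]
  refine ⟨c, hc, fun f hf hne => ?_⟩
  obtain ⟨⟨hqc, hloc⟩, hlt⟩ := hf
  set B := (bloNorm n δ f).toReal with hBdef
  have hB : 0 < B := ENNReal.toReal_pos hne hlt.ne
  have hbd : BLOBd n δ f B := by
    intro Q
    have hQ := Q.side_pos
    have h1 : integH n δ (fun x => |f x - essInfQ n δ f Q|) Q.toSet / hContent n δ Q.toSet ≤
        bloNorm n δ f := by
      unfold bloNorm
      exact le_iSup (fun Q : Cube n =>
        integH n δ (fun x => |f x - essInfQ n δ f Q|) Q.toSet / hContent n δ Q.toSet) Q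
    rw [hc_cube hδn hδ0, ENNReal.div_le_iff (by simp; positivity) ENNReal.ofReal_ne_top] at h1
    rwa [ENNReal.ofReal_mul hB.le, hBdef, ENNReal.ofReal_toReal hlt.ne]
  have hexp := exp_avg hδn hδ0 f B hB hbd c hc hcA
  have habs : (fun x => |Real.exp (c * f x / B)|) = fun x => Real.exp (c * f x / B) := by
    ext x; exact abs_of_pos (Real.exp_pos _)
  refine ⟨⟨⟨?_, ?_⟩, ?_⟩, ?_⟩
  · intro ε hε
    obtain ⟨O, h1, h2, h3⟩ := hqc ε hε
    refine ⟨O, h1, h2, ?_⟩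
    exact Real.continuous_exp.comp_continuousOn ((continuousOn_const.mul h3).div_const _)
  · intro K hK
    rw [habs]
    obtain ⟨r, hr⟩ := hK.isBounded.subset_closedBall 0
    let Q : Cube n := ⟨fun _ => -(|r| + 1), 2 * (|r| + 1), by positivity⟩
    have hKQ : K ⊆ Q.toSet := by
      intro x hx i
      have h1 : ‖x‖ ≤ r := by simpa using hr hx
      have h2 := abs_le.1 ((norm_le_pi_norm x i).trans h1)
      have h3 := le_abs_self r
      simp only [Q]
      constructor <;> linarith
    exact (integH_mono_set _ hKQ).trans_lt ((hexp Q).trans_lt ENNReal.ofReal_lt_top)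
  · unfold AEContent
    have : {x : Fin n → ℝ | ¬ 0 < Real.exp (c * f x / B)} = ∅ := by
      ext x; simp [Real.exp_pos]
    rw [this, hc_empty hδ0]
  · have hC : (0:ℝ) < 3 * 2 ^ δ * Real.exp (3 * c) := by positivity
    unfold a1Const
    refine lt_of_le_of_lt (sInf_le ⟨ENNReal.ofReal_pos.2 hC, ?_⟩) ENNReal.ofReal_lt_top
    unfold AEContent
    let N : Set (Fin n → ℝ) := {x | f x < -(3 * B)} ∪
      ⋃ p, {x | 0 < essInfQ n δ f (ratCube n p) ∧ x ∈ (ratCube n p).toSet ∧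
        f x < essInfQ n δ f (ratCube n p)}
    have hN : hContent n δ N = 0 := by
      refine le_antisymm ((hc_union hδ0 _ _).trans ?_) zero_le
      rw [lower_bd hδ0 f B hB hbd, hc_iUnion_null hδ0, add_zero]
      intro p
      by_cases hp : 0 < essInfQ n δ f (ratCube n p)
      · refine le_antisymm ?_ zero_le
        rw [← essInfQ_null hδ0 f (ratCube n p) hp]
        exact hc_mono fun x hx => hx.2
      · refine le_antisymm ?_ zero_le
        rw [← hc_empty (n := n) hδ0]
        exact hc_mono fun x hx => hp hx.1
    refine le_antisymm ((hc_mono ?_).trans hN.le) zero_le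
    intro x hx
    by_contra hxN
    apply hx
    unfold maxOp
    rw [habs]
    refine iSup₂_le fun Q hxQ => ?_
    have hQ := Q.side_pos
    obtain ⟨p, hp1, hp2⟩ := exists_ratCube Q
    set R := ratCube n p with hR
    have hRs := R.side_pos
    have hm0 : 0 ≤ essInfQ n δ f R := essInfQ_nonneg f R
    have hfx : essInfQ n δ f R - 3 * B ≤ f x := by
      rcases hm0.eq_or_lt with h | h
      · rw [← h]
        by_contra hcon
        exact hxN (Or.inl (by
          show f x < -(3 * B)
          linarith))
      · by_contra hcon
        refine hxN (Or.inr (mem_iUnion.2 ⟨p, h, hp1 hxQ, ?_⟩))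
        show f x < essInfQ n δ f R
        linarith
    rw [hc_cube hδn hδ0, ENNReal.div_le_iff (by simp; positivity) ENNReal.ofReal_ne_top]
    refine (integH_mono_set _ hp1).trans ((hexp R).trans ?_)
    rw [← ENNReal.ofReal_mul hC.le, ← ENNReal.ofReal_mul (by positivity)]
    apply ENNReal.ofReal_le_ofReal
    have e1 : Real.exp (c * essInfQ n δ f R / B) ≤ Real.exp (3 * c) * Real.exp (c * f x / B) := by
      rw [← Real.exp_add, Real.exp_le_exp]
      have : 3 * c + c * f x / B = c * (f x + 3 * B) / B := by field_simp; ring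
      rw [this]
      gcongr
      linarith
    have e2 : R.side ^ δ ≤ 2 ^ δ * Q.side ^ δ := by
      rw [← Real.mul_rpow (by norm_num) hQ.le]
      exact Real.rpow_le_rpow hRs.le hp2 hδ0.le
    calc 3 * Real.exp (c * essInfQ n δ f R / B) * R.side ^ δ
        ≤ 3 * (Real.exp (3 * c) * Real.exp (c * f x / B)) * (2 ^ δ * Q.side ^ δ) := by gcongr
      _ = _ := by ring
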